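/- From the axioms A1, A2, A3, A4 of Łukasiewicz's infinite-valued sentential calculus, there exist double-negation-free condensed-detachment proofs of each of the formulas A6 = i(i(x,y),i(n(y),n(x))), A7 = i(i(n(x),y),i(n(y),x)), and A8 = i(i(x,n(y)),i(y,n(x))). -/

import Mathlib

/-- Propositional formulas built from countably many variables by implication `i`
and negation `n`. -/
inductive Fm : Type
  | var : ℕ → Fm
  | i : Fm → Fm → Fm
  | n : Fm → Fm
  deriving DecidableEq

namespace Fm

/-- Homomorphic extension of a substitution (of formulas for variables). -/
def subst (σ : ℕ → Fm) : Fm → Fm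
  | var k => σ k
  | i a b => i (subst σ a) (subst σ b)
  | n a => n (subst σ a)

/-- The (finite) set of variables occurring in a formula. -/
def vars : Fm → Finset ℕ
  | var k => {k}
  | i a b => vars a ∪ vars b
  | n a => vars a

/-- `Sub s t` : `s` is a (not necessarily proper) subformula of `t`. -/
inductive Sub : Fm → Fm → Prop
  | refl (t : Fm) : Sub t t
  | il {s a b : Fm} : Sub s a → Sub s (i a b)
  | ir {s a b : Fm} : Sub s b → Sub s (i a b)
  | neg {s a : Fm} : Sub s a → Sub s (n a)

end Fm

/-- The renaming substitution induced by a permutation of the variables. -/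
def renameSubst (p : Equiv.Perm ℕ) : ℕ → Fm := fun k => Fm.var (p k)

/-- `AlphVar A B` : `B` is an alphabetic variant of `A`
(obtained from `A` by an injective renaming of variables). -/
def AlphVar (A B : Fm) : Prop := ∃ p : Equiv.Perm ℕ, B = A.subst (renameSubst p)

/-- `σ` unifies `A` and `C`. -/
def Unifies (σ : ℕ → Fm) (A C : Fm) : Prop := A.subst σ = C.subst σ

/-- `σ` is a most general unifier of `A` and `C`. -/
def IsMGU (σ : ℕ → Fm) (A C : Fm) : Prop :=
  Unifies σ A C ∧ ∀ τ : ℕ → Fm, Unifies τ A C → ∃ ρ : ℕ → Fm, ∀ k, τ k = (σ k).subst ρ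

/-- Condensed detachment: from the major premiss `maj = i(A,B)` and minor premiss
`minor` (renamed to `C`, sharing no variables with the major premiss), if `σ` is a
most general unifier of `A` and `C`, conclude `Bσ` (up to renaming of variables). -/
def CD (maj minor concl : Fm) : Prop :=
  ∃ (A B C : Fm) (σ : ℕ → Fm),
    maj = Fm.i A B ∧ AlphVar minor C ∧ Disjoint (Fm.i A B).vars C.vars ∧
    IsMGU σ A C ∧ AlphVar (B.subst σ) concl

/-- A formula contains a double negation if it has a subformula of the form `n(n(t))`. -/
def ContainsDN (A : Fm) : Prop := ∃ t : Fm, Fm.Sub (Fm.n (Fm.n t)) A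

/-- Existence of a condensed-detachment proof from axiom set `L` in which every
*deduced* (non-axiom) step satisfies the predicate `allowed`.  A step is an
alphabetic variant of an axiom of `L` or follows from two earlier steps by
condensed detachment. -/
inductive CDProof (L : Set Fm) (allowed : Fm → Prop) : Fm → Prop
  | ax {a b : Fm} : a ∈ L → AlphVar a b → CDProof L allowed b
  | cd {p q c : Fm} : CDProof L allowed p → CDProof L allowed q → CD p q c → allowed c →
      CDProof L allowed c

/-- `B` is provable from `L` by condensed detachment. -/
def CDProvable (L : Set Fm) (B : Fm) : Prop := CDProof L (fun _ => True) B

/-- A formula is double-negation free. -/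
def DNFree (f : Fm) : Prop := ¬ ContainsDN f

/-- `B` has a double-negation-free condensed-detachment proof from `L`
(no deduced step contains a double negation). -/
def DNFreeCDProvable (L : Set Fm) (B : Fm) : Prop := CDProof L DNFree B

/-- Every doubly negated subformula of `f` is (an alphabetic variant of) a doubly
negated subformula of `B`. -/
def DNOk (B : Fm) : Fm → Prop := fun f =>
  ∀ t : Fm, Fm.Sub (Fm.n (Fm.n t)) f → ∃ s : Fm, Fm.Sub (Fm.n (Fm.n s)) B ∧ AlphVar s t

/-- Existence of a proof from axioms `L` and (variable-free) assumptions `Δ` using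
modus ponens and substitution, in which every deduced step satisfies `allowed`. -/
inductive HProof (L Δ : Set Fm) (allowed : Fm → Prop) : Fm → Prop
  | ax {a : Fm} : a ∈ L → HProof L Δ allowed a
  | hyp {a : Fm} : a ∈ Δ → HProof L Δ allowed a
  | mp {a b : Fm} : HProof L Δ allowed (Fm.i a b) → HProof L Δ allowed a → allowed b →
      HProof L Δ allowed b
  | subst {a : Fm} (σ : ℕ → Fm) : HProof L Δ allowed a → allowed (a.subst σ) →
      HProof L Δ allowed (a.subst σ)

/-- Existence of a proof by modus ponens only from the set `S` of premisses, in which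
every deduced step satisfies `allowed`. -/
inductive MPProof (S : Set Fm) (allowed : Fm → Prop) : Fm → Prop
  | prem {a : Fm} : a ∈ S → MPProof S allowed a
  | mp {a b : Fm} : MPProof S allowed (Fm.i a b) → MPProof S allowed a → allowed b →
      MPProof S allowed b

/-- The set of substitution instances of members of `L`. -/
def SubstInstances (L : Set Fm) : Set Fm := {b | ∃ a ∈ L, ∃ σ : ℕ → Fm, b = a.subst σ}

/-- A formula containing no variables. -/
def VarFree (A : Fm) : Prop := A.vars = ∅

/-- Replace all occurrences of the selected doubly negated subformulas `n(n(q))`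
(`q ∈ S`) by `q`. -/
def eraseDN (S : Finset Fm) : Fm → Fm
  | .var k => .var k
  | .i a b => .i (eraseDN S a) (eraseDN S b)
  | .n (.var k) => .n (.var k)
  | .n (.i a b) => .n (.i (eraseDN S a) (eraseDN S b))
  | .n (.n q) => if q ∈ S then eraseDN S q else .n (eraseDN S (.n q))

/-- `L` admits strong double-negation elimination: whenever `B` is provable from `L`
by condensed detachment and `B*` is obtained from `B` by erasing all occurrences of
a chosen set of doubly negated subformulas of `B`, then `B*` has a condensed-detachment
proof from `L` whose deduced steps contain no doubly negated subformulas other than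
(alphabetic variants of) those occurring in `B*`. -/
def StrongDNE (L : Set Fm) : Prop :=
  ∀ (B : Fm) (S : Finset Fm), CDProvable L B → (∀ q ∈ S, Fm.Sub (.n (.n q)) B) →
    CDProof L (DNOk (eraseDN S B)) (eraseDN S B)

/-- Replace every occurrence of the variable `v` by `n(v)` and cancel the resulting
double negations. -/
def flipNeg (v : ℕ) : Fm → Fm
  | .var k => if k = v then .n (.var v) else .var k
  | .i a b => .i (flipNeg v a) (flipNeg v b)
  | .n a => if a = .var v then .var v else .n (flipNeg v a)

/-- Membership in `L*`: the closure of `L` under the operation of replacing a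
negated variable `x` (i.e. one with `n(x)` occurring) everywhere by `n(x)`,
cancelling resulting double negations. -/
inductive StarMem (L : Set Fm) : Fm → Prop
  | base {a : Fm} : a ∈ L → StarMem L a
  | step {a : Fm} {v : ℕ} : StarMem L a → Fm.Sub (.n (.var v)) a → StarMem L (flipNeg v a)

/-- D1 = i(x,x) -/
def D1 : Fm := .i (.var 0) (.var 0)
/-- D2 = i(i(x,x),i(n(x),n(x))) -/
def D2 : Fm := .i (.i (.var 0) (.var 0)) (.i (.n (.var 0)) (.n (.var 0)))
/-- D3 = i(i(x,x),i(i(y,y),i(i(x,y),i(x,y)))) -/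
def D3 : Fm := .i (.i (.var 0) (.var 0))
  (.i (.i (.var 1) (.var 1)) (.i (.i (.var 0) (.var 1)) (.i (.var 0) (.var 1))))

/-- L1 = i(i(x,y),i(i(y,z),i(x,z))) -/
def L1 : Fm := .i (.i (.var 0) (.var 1)) (.i (.i (.var 1) (.var 2)) (.i (.var 0) (.var 2)))
/-- L2 = i(i(n(x),x),x) -/
def L2 : Fm := .i (.i (.n (.var 0)) (.var 0)) (.var 0)
/-- L3 = i(x,i(n(x),y)) -/
def L3 : Fm := .i (.var 0) (.i (.n (.var 0)) (.var 1))
/-- L4 = i(i(x,n(x)),n(x)) -/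
def L4 : Fm := .i (.i (.var 0) (.n (.var 0))) (.n (.var 0))
/-- L5 = i(n(x),i(x,y)) -/
def L5 : Fm := .i (.n (.var 0)) (.i (.var 0) (.var 1))
/-- The Łukasiewicz axiom system for two-valued propositional calculus. -/
def Lax : Set Fm := {L1, L2, L3}

/-- A1 = i(x,i(y,x)) -/
def A1 : Fm := .i (.var 0) (.i (.var 1) (.var 0))
/-- A2 = i(i(x,y),i(i(y,z),i(x,z))) -/
def A2 : Fm := .i (.i (.var 0) (.var 1)) (.i (.i (.var 1) (.var 2)) (.i (.var 0) (.var 2)))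
/-- A3 = i(i(i(x,y),y),i(i(y,x),x)) -/
def A3 : Fm := .i (.i (.i (.var 0) (.var 1)) (.var 1)) (.i (.i (.var 1) (.var 0)) (.var 0))
/-- A4 = i(i(n(x),n(y)),i(y,x)) -/
def A4 : Fm := .i (.i (.n (.var 0)) (.n (.var 1))) (.i (.var 1) (.var 0))
/-- A6 = i(i(x,y),i(n(y),n(x))) -/
def A6 : Fm := .i (.i (.var 0) (.var 1)) (.i (.n (.var 1)) (.n (.var 0)))
/-- A7 = i(i(n(x),y),i(n(y),x)) -/
def A7 : Fm := .i (.i (.n (.var 0)) (.var 1)) (.i (.n (.var 1)) (.var 0))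
/-- A8 = i(i(x,n(y)),i(y,n(x))) -/
def A8 : Fm := .i (.i (.var 0) (.n (.var 1))) (.i (.var 1) (.n (.var 0)))
/-- The axiom system of Łukasiewicz's infinite-valued sentential calculus. -/
def Aax : Set Fm := {A1, A2, A3, A4}

/-- H1 = i(x,i(y,x)) -/
def H1 : Fm := .i (.var 0) (.i (.var 1) (.var 0))
/-- H2 = i(i(x,i(y,z)),i(i(x,y),i(x,z))) -/
def H2 : Fm := .i (.i (.var 0) (.i (.var 1) (.var 2)))
  (.i (.i (.var 0) (.var 1)) (.i (.var 0) (.var 2)))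
/-- H3 = i(i(x,n(x)),n(x)) -/
def H3 : Fm := .i (.i (.var 0) (.n (.var 0))) (.n (.var 0))
/-- H4 = i(x,i(n(x),y)) -/
def H4 : Fm := .i (.var 0) (.i (.n (.var 0)) (.var 1))
/-- The intuitionistic axiom system H. -/
def Hax : Set Fm := {H1, H2, H3, H4}

namespace Fm

theorem subst_var (t : Fm) : t.subst var = t := by
  induction t <;> simp_all [subst]

theorem subst_subst (σ τ : ℕ → Fm) (t : Fm) :
    (t.subst σ).subst τ = t.subst fun k => (σ k).subst τ := by
  induction t <;> simp_all [subst]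

theorem subst_congr {σ τ : ℕ → Fm} {t : Fm} (h : ∀ k ∈ t.vars, σ k = τ k) :
    t.subst σ = t.subst τ := by
  induction t <;> simp_all [subst, vars]

/-- The substitution sending the variable `x` to `t` and fixing all others. -/
def single (x : ℕ) (t : Fm) : ℕ → Fm := fun k => if k = x then t else var k

theorem subst_single_of_notMem {x : ℕ} {s t : Fm} (h : x ∉ s.vars) :
    s.subst (single x t) = s := by
  conv_rhs => rw [← subst_var s]
  exact subst_congr fun k hk => if_neg fun hkx : k = x => h (hkx ▸ hk)

theorem subst_single_subst {x : ℕ} {t : Fm} {τ : ℕ → Fm} (h : τ x = t.subst τ) (s : Fm) :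
    (s.subst (single x t)).subst τ = s.subst τ := by
  rw [subst_subst]
  refine subst_congr fun k _ => ?_
  by_cases hk : k = x <;> simp_all [single, subst]

/-- Solve the equation `var x = t` and use `solve` for the remaining equations `E`. -/
def eliminate (solve : List (Fm × Fm) → Option (ℕ → Fm)) (x : ℕ) (t : Fm)
    (E : List (Fm × Fm)) : Option (ℕ → Fm) :=
  if t = var x then solve E
  else if x ∈ t.vars then none
  else (solve (E.map fun e => (e.1.subst (single x t), e.2.subst (single x t)))).map
    fun μ k => (single x t k).subst μ

/-- Unification of a list of equations, with bounded recursion depth. -/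
def unify : ℕ → List (Fm × Fm) → Option (ℕ → Fm)
  | _, [] => some var
  | 0, _ :: _ => none
  | d + 1, (i a b, i a' b') :: E => unify d ((a, a') :: (b, b') :: E)
  | d + 1, (n a, n a') :: E => unify d ((a, a') :: E)
  | d + 1, (var x, t) :: E => eliminate (unify d) x t E
  | d + 1, (t, var x) :: E => eliminate (unify d) x t E
  | _ + 1, _ => none

/-- `σ` unifies all equations in `E`, and every unifier of `E` factors through `σ` via
itself. -/
def IsIdemMGU (σ : ℕ → Fm) (E : List (Fm × Fm)) : Prop :=
  (∀ e ∈ E, Unifies σ e.1 e.2) ∧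
    ∀ τ : ℕ → Fm, (∀ e ∈ E, Unifies τ e.1 e.2) → ∀ k, τ k = (σ k).subst τ

theorem IsIdemMGU.eliminate {x : ℕ} {t : Fm} {E : List (Fm × Fm)} {μ : ℕ → Fm}
    (hx : x ∉ t.vars)
    (h : IsIdemMGU μ (E.map fun e => (e.1.subst (single x t), e.2.subst (single x t)))) :
    IsIdemMGU (fun k => (single x t k).subst μ) ((var x, t) :: E) := by
  refine ⟨fun e he => ?_, fun τ hτ k => ?_⟩
  · rw [Unifies, ← subst_subst, ← subst_subst]
    rcases List.mem_cons.1 he with rfl | he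
    · rw [subst_single_of_notMem hx]
      simp [subst, single]
    · exact h.1 _ (List.mem_map_of_mem he)
  · have hxt : τ x = t.subst τ := hτ _ List.mem_cons_self
    have hμ := h.2 τ fun e he => by
      obtain ⟨e, he', rfl⟩ := List.mem_map.1 he
      simpa only [Unifies, subst_single_subst hxt] using hτ e (List.mem_cons_of_mem _ he')
    rw [subst_subst, ← funext hμ]
    exact (subst_single_subst hxt (var k)).symm

theorem IsIdemMGU.congr {σ : ℕ → Fm} {E E' : List (Fm × Fm)} (h : IsIdemMGU σ E)
    (hE : ∀ τ, (∀ e ∈ E', Unifies τ e.1 e.2) ↔ ∀ e ∈ E, Unifies τ e.1 e.2) :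
    IsIdemMGU σ E' :=
  ⟨(hE σ).2 h.1, fun τ hτ => h.2 τ ((hE τ).1 hτ)⟩

theorem isIdemMGU_of_eliminate {solve : List (Fm × Fm) → Option (ℕ → Fm)}
    (hsolve : ∀ {E σ}, solve E = some σ → IsIdemMGU σ E) {x : ℕ} {t : Fm}
    {E : List (Fm × Fm)} {σ : ℕ → Fm} (h : Fm.eliminate solve x t E = some σ) :
    IsIdemMGU σ ((var x, t) :: E) := by
  unfold Fm.eliminate at h
  split_ifs at h with ht hx
  · exact (hsolve h).congr fun τ => by simp [ht, Unifies]
  · obtain ⟨μ, hμ, rfl⟩ := Option.map_eq_some_iff.1 h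
    exact (hsolve hμ).eliminate hx

theorem isIdemMGU_of_unify {d : ℕ} {E : List (Fm × Fm)} {σ : ℕ → Fm}
    (h : unify d E = some σ) : IsIdemMGU σ E := by
  induction d generalizing E σ with
  | zero =>
    cases E with
    | nil =>
      obtain rfl : var = σ := by simpa [unify] using h
      simp [IsIdemMGU, subst]
    | cons e E => simp [unify] at h
  | succ d ih =>
    unfold unify at h
    split at h
    · obtain rfl : var = σ := by simpa using h
      simp [IsIdemMGU, subst]
    · contradiction
    · rename_i hd
      cases hd
      exact (ih h).congr fun τ => by simp [Unifies, subst, and_assoc]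
    · rename_i hd
      cases hd
      exact (ih h).congr fun τ => by simp [Unifies, subst]
    · rename_i hd
      cases hd
      exact isIdemMGU_of_eliminate ih h
    · rename_i hd
      cases hd
      exact (isIdemMGU_of_eliminate ih h).congr fun τ => by simp [Unifies, eq_comm]
    · contradiction

/-- Boolean test for the absence of double negations. -/
def dnFree : Fm → Bool
  | var _ => true
  | i a b => dnFree a && dnFree b
  | n (n _) => false
  | n a => dnFree a

theorem dnFree_of_sub {s t : Fm} (h : Sub s t) (ht : t.dnFree) : s.dnFree := by
  induction h with
  | refl => exact ht
  | il _ ih => exact ih (by simp_all [dnFree])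
  | ir _ ih => exact ih (by simp_all [dnFree])
  | @neg a _ ih => exact ih (by cases a <;> simp_all [dnFree])

theorem DNFree_of_dnFree {t : Fm} (ht : t.dnFree) : DNFree t :=
  fun ⟨_, hs⟩ => by simpa [dnFree] using dnFree_of_sub hs ht

/-- The variables of a formula from left to right, with repetitions. -/
def varList : Fm → List ℕ
  | var k => [k]
  | i a b => varList a ++ varList b
  | n a => varList a

/-- A permutation renaming the variables of `t` to `0, 1, 2, …` in order of first
occurrence. -/
def normPerm (t : Fm) : Equiv.Perm ℕ :=
  t.varList.eraseDups.zipIdx.foldl (fun p e => Equiv.swap e.2 (p e.1) * p) 1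

/-- The permutation exchanging `k` and `k + 16` for `k < 16`, used to rename minor
premisses apart from major ones. -/
def exchangePerm : Equiv.Perm ℕ :=
  Function.Involutive.toPerm (fun k => if k < 16 then k + 16 else if k < 32 then k - 16 else k)
    fun k => by grind

/-- The condensed detachment of a major and a minor premiss, with normalized variables. -/
def condense : Fm → Fm → Option Fm
  | i A B, D =>
    let C := D.subst (renameSubst exchangePerm)
    if Disjoint (i A B).vars C.vars then
      (unify 50 [(A, C)]).map fun σ =>
        (B.subst σ).subst (renameSubst (B.subst σ).normPerm)
    else none
  | _, _ => none

theorem CD_of_condense {p q c : Fm} (h : condense p q = some c) : CD p q c := by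
  unfold condense at h
  split at h
  · rename_i A B
    dsimp only at h
    split_ifs at h with hdisj
    obtain ⟨σ, hσ, rfl⟩ := Option.map_eq_some_iff.1 h
    have hmgu := isIdemMGU_of_unify hσ
    exact ⟨A, B, _, σ, rfl, ⟨exchangePerm, rfl⟩, hdisj,
      ⟨hmgu.1 (A, _) (by simp), fun τ hτ => ⟨τ, hmgu.2 τ (by simpa using hτ)⟩⟩, _, rfl⟩
  · contradiction

end Fm

open Fm

theorem AlphVar.refl (a : Fm) : AlphVar a a := ⟨1, (subst_var a).symm⟩

theorem CDProof.of_mem {L : Set Fm} {allowed : Fm → Prop} {a : Fm} (h : a ∈ L) :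
    CDProof L allowed a :=
  .ax h (.refl a)

theorem DNFreeCDProvable.detach {L : Set Fm} {p q c : Fm} (hp : DNFreeCDProvable L p)
    (hq : DNFreeCDProvable L q) (h : condense p q = some c ∧ c.dnFree) :
    DNFreeCDProvable L c :=
  .cd hp hq (CD_of_condense h.1) (DNFree_of_dnFree h.2)

namespace Lukasiewicz

/-- The first variable. -/
abbrev x : Fm := var 0
/-- The second variable. -/
abbrev y : Fm := var 1
/-- The third variable. -/
abbrev z : Fm := var 2
/-- The fourth variable. -/
abbrev w : Fm := var 3

theorem a1 : DNFreeCDProvable Aax A1 := .of_mem (by simp [Aax])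

theorem a2 : DNFreeCDProvable Aax A2 := .of_mem (by simp [Aax])

theorem a3 : DNFreeCDProvable Aax A3 := .of_mem (by simp [Aax])

theorem a4 : DNFreeCDProvable Aax A4 := .of_mem (by simp [Aax])

theorem a1_comp : DNFreeCDProvable Aax (i (i (i x y) z) (i y z)) :=
  a2.detach a1 (by decide +kernel)

theorem assertion : DNFreeCDProvable Aax (i x (i (i x y) y)) :=
  a1_comp.detach a3 (by decide +kernel)

theorem a2_comp : DNFreeCDProvable Aax (i (i (i (i x y) (i z y)) w) (i (i z x) w)) :=
  a2.detach a2 (by decide +kernel)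

theorem assertion_comp : DNFreeCDProvable Aax (i (i (i (i x y) y) z) (i x z)) :=
  a2.detach assertion (by decide +kernel)

theorem imp_comm : DNFreeCDProvable Aax (i (i x (i y z)) (i y (i x z))) :=
  a2_comp.detach assertion_comp (by decide +kernel)

theorem weaken_refl : DNFreeCDProvable Aax (i x (i y y)) :=
  imp_comm.detach a1 (by decide +kernel)

theorem imp_refl : DNFreeCDProvable Aax (i x x) :=
  weaken_refl.detach a1 (by decide +kernel)

theorem imp_comp : DNFreeCDProvable Aax (i (i x y) (i (i z x) (i z y))) :=
  imp_comm.detach a2 (by decide +kernel)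

theorem neg_elim : DNFreeCDProvable Aax (i (n x) (i x y)) :=
  a1_comp.detach a4 (by decide +kernel)

theorem neg_elim_comm : DNFreeCDProvable Aax (i x (i (n x) y)) :=
  imp_comm.detach neg_elim (by decide +kernel)

theorem ex_falso : DNFreeCDProvable Aax (i (n (i x x)) y) :=
  neg_elim_comm.detach imp_refl (by decide +kernel)

theorem a4_comm : DNFreeCDProvable Aax (i x (i (i (n y) (n x)) y)) :=
  imp_comm.detach a4 (by decide +kernel)

theorem by_contra : DNFreeCDProvable Aax (i (i (n x) (n (i y y))) x) :=
  a4_comm.detach imp_refl (by decide +kernel)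

theorem a3_comm : DNFreeCDProvable Aax (i (i x y) (i (i (i y x) x) y)) :=
  imp_comm.detach a3 (by decide +kernel)

theorem stable : DNFreeCDProvable Aax (i (i (i x (n (i y y))) (n (i y y))) x) :=
  a3_comm.detach ex_falso (by decide +kernel)

theorem by_contra_comp : DNFreeCDProvable Aax (i (i x y) (i (i (n x) (n (i z z))) y)) :=
  a2.detach by_contra (by decide +kernel)

theorem by_contra_comp_comp : DNFreeCDProvable Aax
    (i (i (i (i (n x) (n (i y y))) z) w) (i (i x z) w)) :=
  a2.detach by_contra_comp (by decide +kernel)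

theorem neg_intro : DNFreeCDProvable Aax (i (i x (n (i y y))) (n x)) :=
  by_contra_comp_comp.detach stable (by decide +kernel)

theorem neg_elim_comp : DNFreeCDProvable Aax (i (i (i x y) z) (i (n x) z)) :=
  a2.detach neg_elim (by decide +kernel)

theorem comp_neg_elim : DNFreeCDProvable Aax (i (i x (n y)) (i x (i y z))) :=
  imp_comp.detach neg_elim (by decide +kernel)

theorem comp_neg_intro : DNFreeCDProvable Aax (i (i x (i y (n (i z z)))) (i x (n y))) :=
  imp_comp.detach neg_intro (by decide +kernel)

theorem comp_by_contra : DNFreeCDProvable Aax (i (i x (i (n y) (n (i z z)))) (i x y)) :=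
  imp_comp.detach by_contra (by decide +kernel)

theorem neg_elim_comp_comp : DNFreeCDProvable Aax (i (i (i (n x) y) z) (i (i (i x w) y) z)) :=
  a2.detach neg_elim_comp (by decide +kernel)

theorem neg_of_imp : DNFreeCDProvable Aax (i (i (i x y) (i z (n (i w w)))) (i (n x) (n z))) :=
  neg_elim_comp_comp.detach comp_neg_intro (by decide +kernel)

theorem of_neg_imp : DNFreeCDProvable Aax (i (i (i x y) (i (n z) (n (i w w)))) (i (n x) z)) :=
  neg_elim_comp_comp.detach comp_by_contra (by decide +kernel)

theorem a6 : DNFreeCDProvable Aax A6 :=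
  a2_comp.detach neg_of_imp (by decide +kernel)

theorem a7 : DNFreeCDProvable Aax A7 :=
  a2_comp.detach of_neg_imp (by decide +kernel)

theorem comp_neg_elim_comp : DNFreeCDProvable Aax (i (i (i x (i y z)) w) (i (i x (n y)) w)) :=
  a2.detach comp_neg_elim (by decide +kernel)

theorem imp_neg_comm : DNFreeCDProvable Aax (i (i x (n y)) (i y (i x z))) :=
  comp_neg_elim_comp.detach imp_comm (by decide +kernel)

theorem imp_neg_comm_comp : DNFreeCDProvable Aax (i (i (i x (i y z)) w) (i (i y (n x)) w)) :=
  a2.detach imp_neg_comm (by decide +kernel)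

theorem a8 : DNFreeCDProvable Aax A8 :=
  imp_neg_comm_comp.detach comp_neg_intro (by decide +kernel)

end Lukasiewicz

/-- From the axioms A1-A4 of Łukasiewicz's infinite-valued sentential calculus there
exist double-negation-free condensed-detachment proofs of A6, A7, and A8. -/
theorem stmt13 :
    DNFreeCDProvable Aax A6 ∧ DNFreeCDProvable Aax A7 ∧ DNFreeCDProvable Aax A8 := by
  exact ⟨Lukasiewicz.a6, Lukasiewicz.a7, Lukasiewicz.a8⟩
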